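/- There is no discrimination procedure that asymptotically discriminates equality of single-dimensional marginals of B-processes: there is no family of measurable maps D_n : A^n × A^n → {0,1} such that for every pair of binary-valued B-processes ρ_x, ρ_y independently generating sequences X_1,X_2,… and Y_1,Y_2,…, the limit lim_{n→∞} E D_n((X_1,…,X_n),(Y_1,…,Y_n)) exists and equals 0 if ρ_x(X_1 = 0) = ρ_y(Y_1 = 0) and equals 1 otherwise. -/

import Mathlib

open MeasureTheory Filter Topology

namespace Paper

variable {A : Type*} [MeasurableSpace A]

/-- The left shift on one-sided infinite sequences. -/
def shift (x : ℕ → A) : ℕ → A := fun n => x (n + 1)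

/-- A process distribution is stationary if it is invariant under the left shift. -/
def Stationary (ρ : Measure (ℕ → A)) : Prop := Measure.map shift ρ = ρ

/-- A set of sequences depends only on the first `k` coordinates. -/
def DependsOn (B : Set (ℕ → A)) (k : ℕ) : Prop :=
  ∀ x y : ℕ → A, (∀ i < k, x i = y i) → (x ∈ B ↔ y ∈ B)

/-- Empirical frequency of the `k`-dimensional event `B` in the first `n` symbols of `x`. -/
noncomputable def freq (B : Set (ℕ → A)) (k n : ℕ) (x : ℕ → A) : ℝ :=
  if k ≤ n then
    (∑ i ∈ Finset.range (n - k + 1), Set.indicator B (fun _ => (1 : ℝ)) fun j => x (i + j)) /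
      ((n : ℝ) - k + 1)
  else 0

/-- Ergodicity: the empirical frequency of every finite-dimensional event converges
almost surely to a constant. -/
def ErgodicFreq (ρ : Measure (ℕ → A)) : Prop :=
  ∀ (k : ℕ) (B : Set (ℕ → A)), MeasurableSet B → DependsOn B k →
    ∃ c : ℝ, ∀ᵐ x ∂ρ, Tendsto (fun n => freq B k n x) atTop (𝓝 c)

/-- The cylinder set of sequences starting with the word `u`. -/
def listCyl (u : List A) : Set (ℕ → A) := {x | ∀ i : Fin u.length, x i = u.get i}

/-- `dbarLe ρx ρy ε` : there is a stationary coupling of `ρx` and `ρy` whose first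
coordinates disagree with probability at most `ε`; i.e., `d̄(ρx,ρy) ≤ ε` witnessed
by a coupling. -/
def dbarLe (ρx ρy : Measure (ℕ → A)) (ε : ℝ) : Prop :=
  ∃ ν : Measure (ℕ → A × A), IsProbabilityMeasure ν ∧ Stationary ν ∧
    ν.map (fun z => fun n => (z n).1) = ρx ∧
    ν.map (fun z => fun n => (z n).2) = ρy ∧
    ν {z | (z 0).1 ≠ (z 0).2} ≤ ENNReal.ofReal ε

/-- A (stationary) process is `k`-step Markov: the conditional probability of the next
symbol given the past depends only on the last `k` symbols, expressed via cylinder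
probabilities: `μ(w·a) μ(lastK) = μ(lastK·a) μ(w)` where `lastK` is the suffix of `w`
of length `k`. -/
def IsMarkovOfOrder (μ : Measure (ℕ → A)) (k : ℕ) : Prop :=
  ∀ (w : List A) (a : A), k ≤ w.length →
    μ (listCyl (w ++ [a])) * μ (listCyl (w.drop (w.length - k))) =
      μ (listCyl (w.drop (w.length - k) ++ [a])) * μ (listCyl w)

/-- Aperiodicity of a stationary `k`-step Markov process: for every word `u` of length `k`
of positive probability, the set of return times of `u` has greatest common divisor 1. -/
def AperiodicMarkov (μ : Measure (ℕ → A)) (k : ℕ) : Prop :=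
  ∀ u : List A, u.length = k → μ (listCyl u) ≠ 0 →
    ∀ d : ℕ,
      (∀ n : ℕ, 1 ≤ n →
        μ (listCyl u ∩ {x | ∀ i : Fin u.length, x (n + i) = u.get i}) ≠ 0 → d ∣ n) →
      d = 1

/-- A B-process: a stationary process in the `d̄`-closure of the set of all aperiodic
stationary ergodic `k`-step Markov processes, `k ∈ ℕ`. -/
def IsBProcess (ρ : Measure (ℕ → A)) : Prop :=
  IsProbabilityMeasure ρ ∧ Stationary ρ ∧
    ∀ ε : ℝ, 0 < ε →
      ∃ (μ : Measure (ℕ → A)) (k : ℕ),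
        IsProbabilityMeasure μ ∧ Stationary μ ∧ ErgodicFreq μ ∧
        IsMarkovOfOrder μ k ∧ AperiodicMarkov μ k ∧ dbarLe ρ μ ε

/-- The expected output `E D_n((X_1,…,X_n),(Y_1,…,Y_n))` of a discrimination procedure on
two independent samples generated by `ρx` and `ρy`. -/
noncomputable def expOut (D : (n : ℕ) → (Fin n → A) → (Fin n → A) → Bool)
    (ρx ρy : Measure (ℕ → A)) (n : ℕ) : ℝ :=
  ∫ z, (if D n (fun i => z.1 i) (fun i => z.2 i) then (1 : ℝ) else 0) ∂(ρx.prod ρy)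

section Shift

variable {E α : Type*}

/-- The `n`-fold left shift. -/
def shiftBy (n : ℕ) (ω : ℕ → E) : ℕ → E := fun i => ω (n + i)

@[simp] lemma shiftBy_apply (n : ℕ) (ω : ℕ → E) (i : ℕ) : shiftBy n ω i = ω (n + i) := rfl

@[simp] lemma shiftBy_zero (ω : ℕ → E) : shiftBy 0 ω = ω := by ext i; simp

@[simp] lemma shiftBy_shiftBy (m n : ℕ) (ω : ℕ → E) :
    shiftBy m (shiftBy n ω) = shiftBy (n + m) ω := by
  ext i; simp [add_assoc]

/-- The sequence `t ↦ F (shiftBy t ω)` coded from `ω` by `F`. -/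
def factor (F : (ℕ → E) → α) (ω : ℕ → E) : ℕ → α := fun t => F (shiftBy t ω)

lemma factor_shiftBy (F : (ℕ → E) → α) (n : ℕ) (ω : ℕ → E) :
    factor F (shiftBy n ω) = shiftBy n (factor F ω) := by
  ext i; simp [factor]

/-- The first `n` coordinates of `ω`, continued by a constant. -/
def truncAt (e : E) (n : ℕ) (ω : ℕ → E) : ℕ → E := fun i => if i < n then ω i else e

lemma DependsOn.mono {S : Set (ℕ → E)} {m n : ℕ} (h : DependsOn S m) (hmn : m ≤ n) :
    DependsOn S n :=
  fun x y hxy => h x y fun i hi => hxy i (hi.trans_le hmn)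

lemma DependsOn.preimage_truncAt {S : Set (ℕ → E)} {n : ℕ} (h : DependsOn S n) (e : E) :
    truncAt e n ⁻¹' S = S := by
  ext ω
  exact h _ _ fun i hi => by simp [truncAt, hi]

variable [MeasurableSpace E] [MeasurableSpace α]

@[fun_prop] lemma measurable_shiftBy (n : ℕ) : Measurable (shiftBy n : (ℕ → E) → ℕ → E) := by
  unfold shiftBy; fun_prop

@[fun_prop] lemma measurable_factor {F : (ℕ → E) → α} (hF : Measurable F) :
    Measurable (factor F) :=
  measurable_pi_lambda _ fun t => hF.comp (measurable_shiftBy t)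

lemma comap_le_of_measurable_apply {Ω : Type*} {m : MeasurableSpace Ω} {f : Ω → ℕ → E}
    (h : ∀ i, Measurable fun ω => f ω i) : MeasurableSpace.comap f inferInstance ≤ m :=
  (measurable_pi_iff.2 h).comap_le

end Shift

section Iid

variable {E α : Type*} [MeasurableSpace E] [MeasurableSpace α]
  (κ : Measure E) [IsProbabilityMeasure κ]

/-- The distribution of an i.i.d. sequence with marginal `κ`. -/
noncomputable def iid : Measure (ℕ → E) := Measure.infinitePi fun _ => κ

instance : IsProbabilityMeasure (iid κ) := by unfold iid; infer_instance

lemma measurePreserving_shiftBy (n : ℕ) :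
    MeasurePreserving (shiftBy n) (iid κ) (iid κ) :=
  ⟨measurable_shiftBy n,
    Measure.map_infinitePi_infinitePi_of_inj (P := fun _ : ℕ => κ) (add_right_injective n)⟩

/-- The first `n` coordinates of an i.i.d. sequence are independent of the remaining ones. -/
lemma indepFun_truncAt_shiftBy (e : E) (n : ℕ) :
    ProbabilityTheory.IndepFun (truncAt e n) (shiftBy n) (iid κ) := by
  have h := ProbabilityTheory.iIndepFun_infinitePi (P := fun _ : ℕ => κ)
    (X := fun _ x => x) (fun _ => measurable_id)
  have h2 := ProbabilityTheory.indep_iSup_of_disjoint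
    (m := fun i : ℕ => MeasurableSpace.comap (fun ω : ℕ → E => ω i) inferInstance)
    (fun i => (measurable_pi_apply i).comap_le) h (S := Set.Iio n) (T := Set.Ici n)
    (Set.disjoint_left.2 fun i hi hj => not_le.2 (Set.mem_Iio.1 hi) hj)
  have hcoord (S : Set ℕ) (i : ℕ) (hi : i ∈ S) :
      Measurable[⨆ i ∈ S, MeasurableSpace.comap (fun ω : ℕ → E => ω i) inferInstance]
        fun ω : ℕ → E => ω i :=
    measurable_iff_comap_le.2
      (le_iSup₂ (f := fun i _ => MeasurableSpace.comap (fun ω : ℕ → E => ω i) _) i hi)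
  refine (ProbabilityTheory.IndepFun_iff_Indep _ _ _).2
    (ProbabilityTheory.indep_of_indep_of_le_right
      (ProbabilityTheory.indep_of_indep_of_le_left h2 ?_) ?_)
  · refine comap_le_of_measurable_apply fun i => ?_
    by_cases hi : i < n
    · simpa [truncAt, hi] using hcoord (Set.Iio n) i hi
    · simp [truncAt, hi]
  · exact comap_le_of_measurable_apply fun i => hcoord (Set.Ici n) (n + i) (Nat.le_add_right n i)

lemma iid_inter_shiftBy {S T : Set (ℕ → E)} {m n : ℕ} (hS : MeasurableSet S)
    (hT : MeasurableSet T) (h : DependsOn S m) (hmn : m ≤ n) :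
    iid κ (S ∩ shiftBy n ⁻¹' T) = iid κ S * iid κ T := by
  obtain ⟨e⟩ : Nonempty E := nonempty_of_isProbabilityMeasure κ
  have := (indepFun_truncAt_shiftBy κ e n).measure_inter_preimage_eq_mul S T hS hT
  rwa [(h.mono hmn).preimage_truncAt e,
    (measurePreserving_shiftBy κ n).measure_preimage hT.nullMeasurableSet] at this

/-- The distribution of the sequence coded by `F` from an i.i.d. sequence. -/
noncomputable def factorLaw (F : (ℕ → E) → α) : Measure (ℕ → α) := (iid κ).map (factor F)

variable {F G : (ℕ → E) → α}

lemma isProbabilityMeasure_factorLaw (hF : Measurable F) :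
    IsProbabilityMeasure (factorLaw κ F) :=
  Measure.isProbabilityMeasure_map (measurable_factor hF).aemeasurable

lemma stationary_factorLaw (hF : Measurable F) : Stationary (factorLaw κ F) := by
  have hs : (shift : (ℕ → α) → ℕ → α) = shiftBy 1 := by
    ext x i; simp [shift, add_comm]
  have hcomm : shiftBy 1 ∘ factor F = factor F ∘ shiftBy 1 := by
    ext ω : 1; exact (factor_shiftBy F 1 ω).symm
  unfold Stationary factorLaw
  rw [hs, Measure.map_map (by fun_prop) (by fun_prop), hcomm,
    ← Measure.map_map (by fun_prop) (by fun_prop), (measurePreserving_shiftBy κ 1).map_eq]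

lemma dbarLe_factorLaw [MeasurableEq α]
    (hF : Measurable F) (hG : Measurable G) {ε : ℝ}
    (h : iid κ {ω | F ω ≠ G ω} ≤ ENNReal.ofReal ε) :
    dbarLe (factorLaw κ F) (factorLaw κ G) ε := by
  have hFG : Measurable fun ω => (F ω, G ω) := hF.prodMk hG
  refine ⟨factorLaw κ fun ω => (F ω, G ω), isProbabilityMeasure_factorLaw κ hFG,
    stationary_factorLaw κ hFG, ?_, ?_, ?_⟩
  · unfold factorLaw
    rw [Measure.map_map (by fun_prop) (by fun_prop)]; rfl
  · unfold factorLaw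
    rw [Measure.map_map (by fun_prop) (by fun_prop)]; rfl
  · unfold factorLaw
    have hm : MeasurableSet {z : ℕ → α × α | (z 0).1 ≠ (z 0).2} :=
      (measurableSet_eq_fun (by fun_prop) (by fun_prop)).compl
    rw [Measure.map_apply (by fun_prop) hm]
    simpa [Set.preimage, factor] using h

end Iid

section LargeNumbers

variable {E : Type*} [MeasurableSpace E] (κ : Measure E) [IsProbabilityMeasure κ]

lemma indepFun_indicator_shiftBy {S : Set (ℕ → E)} (hS : MeasurableSet S) {M : ℕ}
    (hM : DependsOn S M) {a b : ℕ} (hab : a + M ≤ b) :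
    ProbabilityTheory.IndepFun (fun ω => S.indicator (fun _ => (1 : ℝ)) (shiftBy a ω))
      (fun ω => S.indicator (fun _ => (1 : ℝ)) (shiftBy b ω)) (iid κ) := by
  refine ProbabilityTheory.indepFun_iff_measure_inter_preimage_eq_mul.2 fun s t hs ht => ?_
  have hf : Measurable (S.indicator fun _ => (1 : ℝ)) := measurable_const.indicator hS
  set U := (S.indicator fun _ => (1 : ℝ)) ⁻¹' s
  set T := (S.indicator fun _ => (1 : ℝ)) ⁻¹' t
  have hU : MeasurableSet U := hf hs
  have hT : MeasurableSet T := hf ht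
  have hUM : DependsOn U M := fun x y hxy => by
    by_cases hx : x ∈ S
    · simp [U, hx, (hM x y hxy).1 hx]
    · simp [U, hx, mt (hM x y hxy).2 hx]
  change iid κ (shiftBy a ⁻¹' U ∩ shiftBy b ⁻¹' T) =
    iid κ (shiftBy a ⁻¹' U) * iid κ (shiftBy b ⁻¹' T)
  have hb : shiftBy b ⁻¹' T = shiftBy a ⁻¹' (shiftBy (b - a) ⁻¹' T) := by
    ext ω; simp [show a + (b - a) = b by omega]
  rw [hb, ← Set.preimage_inter,
    (measurePreserving_shiftBy κ a).measure_preimage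
      (hU.inter (measurable_shiftBy _ hT)).nullMeasurableSet,
    (measurePreserving_shiftBy κ a).measure_preimage hU.nullMeasurableSet,
    (measurePreserving_shiftBy κ a).measure_preimage (measurable_shiftBy _ hT).nullMeasurableSet,
    (measurePreserving_shiftBy κ (b - a)).measure_preimage hT.nullMeasurableSet,
    iid_inter_shiftBy κ hU hT hUM (by omega)]

lemma abs_indicator_one_le {Ω : Type*} (S : Set Ω) (x : Ω) :
    |S.indicator (fun _ => (1 : ℝ)) x| ≤ 1 := by
  by_cases h : x ∈ S <;> simp [h]

lemma indicator_one_nonneg {Ω : Type*} (S : Set Ω) (x : Ω) :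
    0 ≤ S.indicator (fun _ => (1 : ℝ)) x :=
  Set.indicator_nonneg (fun _ _ => zero_le_one) x

/-- If the averages of a bounded sequence along each residue class modulo `M` converge to `c`,
then so do its averages. -/
lemma tendsto_average_of_residues {u : ℕ → ℝ} {C c : ℝ} (hu : ∀ i, |u i| ≤ C) {M : ℕ}
    (hM : 0 < M)
    (h : ∀ r < M, Tendsto (fun m : ℕ => (∑ q ∈ Finset.range m, u (r + M * q)) / m) atTop (𝓝 c)) :
    Tendsto (fun n : ℕ => (∑ i ∈ Finset.range n, u i) / n) atTop (𝓝 c) := by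
  have hM' : (M : ℝ) ≠ 0 := by positivity
  have hblock (m : ℕ) : ∑ i ∈ Finset.range (M * m), u i =
      ∑ r ∈ Finset.range M, ∑ q ∈ Finset.range m, u (r + M * q) := by
    induction m with
    | zero => simp
    | succ m ih =>
      rw [Nat.mul_succ, Finset.sum_range_add, ih, ← Finset.sum_add_distrib]
      refine Finset.sum_congr rfl fun r _ => ?_
      rw [Finset.sum_range_succ, add_comm r]
  have hdiv : Tendsto (fun n : ℕ => n / M) atTop atTop :=
    Nat.tendsto_div_const_atTop hM.ne'
  have hratio : Tendsto (fun n : ℕ => ((n / M : ℕ) : ℝ) / n) atTop (𝓝 (1 / M)) := by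
    have := (tendsto_nat_floor_mul_div_atTop (R := ℝ) (a := 1 / M) (by positivity)).comp
      tendsto_natCast_atTop_atTop
    refine this.congr fun n => ?_
    simp only [Function.comp]
    rw [one_div_mul_eq_div, Nat.floor_div_eq_div]
  have hmain : Tendsto (fun n : ℕ => (∑ r ∈ Finset.range M,
      (∑ q ∈ Finset.range (n / M), u (r + M * q)) / ((n / M : ℕ) : ℝ)) *
        (((n / M : ℕ) : ℝ) / n)) atTop (𝓝 c) := by
    have h1 := tendsto_finsetSum (Finset.range M) fun r hr =>
      (h r (Finset.mem_range.1 hr)).comp hdiv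
    have h2 := h1.mul hratio
    have hc : (∑ _r ∈ Finset.range M, c) * (1 / (M : ℝ)) = c := by
      simp; field_simp
    rw [hc] at h2
    exact h2
  have hrest : Tendsto (fun n : ℕ => (∑ i ∈ Finset.range (n % M), u (M * (n / M) + i)) / (n : ℝ))
      atTop (𝓝 0) := by
    refine squeeze_zero_norm (a := fun n : ℕ => M * C / n) (fun n => ?_)
      (tendsto_const_div_atTop_nhds_zero_nat _)
    have hC : 0 ≤ C := (abs_nonneg _).trans (hu 0)
    rw [norm_div, Real.norm_natCast]
    gcongr
    calc ‖∑ i ∈ Finset.range (n % M), u (M * (n / M) + i)‖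
        ≤ ∑ i ∈ Finset.range (n % M), C := norm_sum_le_of_le _ fun i _ => hu _
      _ = (n % M : ℕ) * C := by simp
      _ ≤ M * C := by gcongr; exact (Nat.mod_lt _ hM).le
  have hsum := hmain.add hrest
  rw [add_zero] at hsum
  refine hsum.congr fun n => ?_
  conv_rhs => rw [← Nat.div_add_mod n M, Finset.sum_range_add, hblock, Nat.div_add_mod]
  rw [add_div, ← Finset.sum_div]
  congr 1
  rcases Nat.eq_zero_or_pos (n / M) with h0 | h0
  · simp [h0]
  · have : ((n / M : ℕ) : ℝ) ≠ 0 := by positivity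
    rw [div_mul_div_cancel₀ this]

/-- Strong law of large numbers for an event depending on finitely many coordinates. -/
lemma ae_tendsto_average_of_dependsOn {S : Set (ℕ → E)} (hS : MeasurableSet S) {M : ℕ}
    (hM : DependsOn S M) :
    ∀ᵐ ω ∂iid κ, Tendsto (fun n : ℕ => (∑ i ∈ Finset.range n,
      S.indicator (fun _ => (1 : ℝ)) (shiftBy i ω)) / n) atTop (𝓝 ((iid κ).real S)) := by
  have hmeas (a : ℕ) : Measurable fun ω : ℕ → E => S.indicator (fun _ => (1 : ℝ)) (shiftBy a ω) :=
    (measurable_const.indicator hS).comp (measurable_shiftBy a)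
  have hmap (a : ℕ) : (iid κ).map (fun ω => S.indicator (fun _ => (1 : ℝ)) (shiftBy a ω)) =
      (iid κ).map (S.indicator fun _ => (1 : ℝ)) := by
    rw [← (measurePreserving_shiftBy κ a).map_eq, Measure.map_map
      (measurable_const.indicator hS) (measurable_shiftBy a),
      (measurePreserving_shiftBy κ a).map_eq]
    rfl
  have hint (a : ℕ) : ∫ ω, S.indicator (fun _ => (1 : ℝ)) (shiftBy a ω) ∂iid κ =
      (iid κ).real S := by
    rw [← integral_indicator_one hS]
    change _ = ∫ ω, S.indicator (fun _ => (1 : ℝ)) ω ∂iid κ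
    conv_rhs => rw [← (measurePreserving_shiftBy κ a).map_eq]
    rw [integral_map (measurable_shiftBy a).aemeasurable
      (measurable_const.indicator hS).aestronglyMeasurable]
  have key (r : ℕ) : ∀ᵐ ω ∂iid κ, Tendsto (fun m : ℕ => (∑ q ∈ Finset.range m,
      S.indicator (fun _ => (1 : ℝ)) (shiftBy (r + (M + 1) * q) ω)) / m) atTop
        (𝓝 ((iid κ).real S)) := by
    have := ProbabilityTheory.strong_law_ae_real (μ := iid κ)
      (fun q ω => S.indicator (fun _ => (1 : ℝ)) (shiftBy (r + (M + 1) * q) ω)) ?_ ?_ ?_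
    · rwa [hint] at this
    · refine Integrable.of_bound (C := 1) (hmeas _).aestronglyMeasurable
        (ae_of_all _ fun ω => abs_indicator_one_le S _)
    · intro a b hab
      rcases lt_or_gt_of_ne hab with h | h
      · exact indepFun_indicator_shiftBy κ hS (hM.mono (Nat.le_succ M)) (by nlinarith)
      · exact (indepFun_indicator_shiftBy κ hS (hM.mono (Nat.le_succ M)) (by nlinarith)).symm
    · exact fun i => ⟨(hmeas _).aemeasurable, (hmeas _).aemeasurable, by rw [hmap, hmap]⟩
  filter_upwards [ae_all_iff.2 key] with ω hω
  exact tendsto_average_of_residues (fun i => abs_indicator_one_le S (shiftBy i ω))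
    (Nat.succ_pos M) fun r _ => hω r

/-- `S` is approximated from inside and outside by events depending on finitely many coordinates. -/
def FinitelyApprox (S : Set (ℕ → E)) : Prop :=
  ∀ η : ℝ, 0 < η → ∃ (N : ℕ) (U T : Set (ℕ → E)), MeasurableSet U ∧ MeasurableSet T ∧
    DependsOn U N ∧ DependsOn T N ∧ U ⊆ S ∧ S ⊆ U ∪ T ∧ (iid κ).real T < η

lemma ae_tendsto_average_of_finitelyApprox {S : Set (ℕ → E)}
    (h : FinitelyApprox κ S) :
    ∀ᵐ ω ∂iid κ, Tendsto (fun n : ℕ => (∑ i ∈ Finset.range n,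
      S.indicator (fun _ => (1 : ℝ)) (shiftBy i ω)) / n) atTop (𝓝 ((iid κ).real S)) := by
  have hη (k : ℕ) : (0 : ℝ) < 1 / ((k : ℝ) + 1) := by positivity
  choose N U T hU hT hUN hTN hUS hST hTη using fun k : ℕ => h (1 / ((k : ℝ) + 1)) (hη k)
  filter_upwards [ae_all_iff.2 fun k => ae_tendsto_average_of_dependsOn κ (hU k) (hUN k),
    ae_all_iff.2 fun k => ae_tendsto_average_of_dependsOn κ (hT k) (hTN k)] with ω hωU hωT
  rw [Metric.tendsto_atTop]
  intro ε hε
  obtain ⟨k, hk⟩ := exists_nat_one_div_lt (show 0 < ε / 4 by positivity)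
  obtain ⟨n₁, hn₁⟩ := Metric.tendsto_atTop.1 (hωU k) (ε / 4) (by positivity)
  obtain ⟨n₂, hn₂⟩ := Metric.tendsto_atTop.1 (hωT k) (ε / 4) (by positivity)
  refine ⟨max n₁ n₂, fun n hn => ?_⟩
  have h1 := hn₁ n (le_of_max_le_left hn)
  have h2 := hn₂ n (le_of_max_le_right hn)
  have hlow : (∑ i ∈ Finset.range n, (U k).indicator (fun _ => (1 : ℝ)) (shiftBy i ω)) / (n : ℝ) ≤
      (∑ i ∈ Finset.range n, S.indicator (fun _ => (1 : ℝ)) (shiftBy i ω)) / (n : ℝ) := by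
    gcongr with i hi
    exact hUS k
  have hupp : (∑ i ∈ Finset.range n, S.indicator (fun _ => (1 : ℝ)) (shiftBy i ω)) / (n : ℝ) ≤
      (∑ i ∈ Finset.range n, (U k).indicator (fun _ => (1 : ℝ)) (shiftBy i ω)) / (n : ℝ) +
      (∑ i ∈ Finset.range n, (T k).indicator (fun _ => (1 : ℝ)) (shiftBy i ω)) / (n : ℝ) := by
    rw [← add_div, ← Finset.sum_add_distrib]
    gcongr with i hi
    by_cases hs : shiftBy i ω ∈ S
    · rcases hST k hs with hu | ht
      · simp only [Set.indicator_of_mem hs, Set.indicator_of_mem hu]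
        linarith [indicator_one_nonneg (T k) (shiftBy i ω)]
      · simp only [Set.indicator_of_mem hs, Set.indicator_of_mem ht]
        linarith [indicator_one_nonneg (U k) (shiftBy i ω)]
    · rw [Set.indicator_of_notMem hs]
      exact add_nonneg (indicator_one_nonneg _ _) (indicator_one_nonneg _ _)
  have m1 : (iid κ).real (U k) ≤ (iid κ).real S := measureReal_mono (hUS k)
  have m2 : (iid κ).real S ≤ (iid κ).real (U k) + (iid κ).real (T k) :=
    (measureReal_mono (hST k)).trans (measureReal_union_le _ _)
  have m3 := hTη k
  rw [Real.dist_eq, abs_lt] at h1 h2 ⊢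
  constructor <;> linarith

end LargeNumbers

section Words

variable {α : Type*}

lemma mem_listCyl {u : List α} {x : ℕ → α} :
    x ∈ listCyl u ↔ ∀ i, ∀ h : i < u.length, x i = u[i] :=
  ⟨fun h i hi => h ⟨i, hi⟩, fun h i => h i i.2⟩

lemma mem_listCyl_append {u v : List α} {x : ℕ → α} :
    x ∈ listCyl (u ++ v) ↔ x ∈ listCyl u ∧ shiftBy u.length x ∈ listCyl v := by
  simp only [mem_listCyl, List.length_append, shiftBy_apply]
  refine ⟨fun h => ⟨fun i hi => ?_, fun i hi => ?_⟩, fun h i hi => ?_⟩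
  · rw [h i (by omega), List.getElem_append_left hi]
  · rw [h (u.length + i) (by omega), List.getElem_append_right (by omega)]
    simp
  · rcases lt_or_ge i u.length with hu | hu
    · rw [List.getElem_append_left hu, h.1 i hu]
    · rw [List.getElem_append_right hu, ← h.2 (i - u.length) (by omega)]
      congr 1
      omega

lemma dependsOn_listCyl (u : List α) : DependsOn (listCyl u) u.length := fun x y hxy => by
  simp only [mem_listCyl]
  exact forall₂_congr fun i hi => by rw [hxy i hi]

lemma measurableSet_listCyl [MeasurableSpace α] [MeasurableSingletonClass α] (u : List α) :
    MeasurableSet (listCyl u) := by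
  have : listCyl u = ⋂ i : Fin u.length, (fun x : ℕ → α => x i) ⁻¹' {u.get i} := by
    ext x; simp [listCyl]
  rw [this]
  exact MeasurableSet.iInter fun i => measurable_pi_apply _ (measurableSet_singleton _)

end Words

section Renewal

variable {E : Type*}

open Classical in
/-- The indicator of an event, with values in `Bool`. -/
noncomputable def mark (S : Set (ℕ → E)) (ω : ℕ → E) : Bool := decide (ω ∈ S)

@[simp] lemma mark_eq_true {S : Set (ℕ → E)} {ω : ℕ → E} : mark S ω = true ↔ ω ∈ S := by
  simp [mark]

@[simp] lemma mark_eq_false {S : Set (ℕ → E)} {ω : ℕ → E} : mark S ω = false ↔ ω ∉ S := by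
  simp [mark]

/-- The event that no position `i` carries a mask `ℓ (ω i)` reaching back to the origin. -/
def clear (ℓ : E → ℕ) : Set (ℕ → E) := {ω | ∀ i, ℓ (ω i) ≤ i}

open Classical in
/-- The distance from the origin to the next renewal, when position `n` is declared a renewal, a
position is a renewal if no mask before the next renewal reaches back to it, and a renewal is forced
whenever the next one is `K` steps ahead. -/
noncomputable def age (ℓ : E → ℕ) (K : ℕ) : ℕ → (ℕ → E) → ℕ
  | 0, _ => 0
  | n + 1, ω =>
    if age ℓ K n (shiftBy 1 ω) + 1 = K ∨ ∀ i ≤ age ℓ K n (shiftBy 1 ω), ℓ (ω i) ≤ i then 0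
    else age ℓ K n (shiftBy 1 ω) + 1

/-- The event that the origin is a renewal, for the renewals determined by `age` far ahead. -/
def renewal (ℓ : E → ℕ) (K : ℕ) : Set (ℕ → E) := {ω | ∀ᶠ n in atTop, age ℓ K n ω = 0}

variable (ℓ : E → ℕ) (K : ℕ)

lemma age_le (n : ℕ) (ω : ℕ → E) : age ℓ K n ω ≤ n := by
  induction n generalizing ω with
  | zero => simp [age]
  | succ n ih =>
    have := ih (shiftBy 1 ω)
    rw [age]; split_ifs <;> omega

lemma age_lt {K : ℕ} (hK : 0 < K) (n : ℕ) (ω : ℕ → E) : age ℓ K n ω < K := by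
  induction n generalizing ω with
  | zero => simpa [age] using hK
  | succ n ih =>
    have := ih (shiftBy 1 ω)
    rw [age]; split_ifs with h
    · exact hK
    · push Not at h
      have := h.1
      omega

lemma age_congr {n : ℕ} {ω ω' : ℕ → E} (h : ∀ i < n, ω i = ω' i) :
    age ℓ K n ω = age ℓ K n ω' := by
  induction n generalizing ω ω' with
  | zero => rfl
  | succ n ih =>
    have hs : age ℓ K n (shiftBy 1 ω) = age ℓ K n (shiftBy 1 ω') :=
      ih fun i hi => h (1 + i) (by omega)
    have hle := age_le ℓ K n (shiftBy 1 ω')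
    have hc : (∀ i ≤ age ℓ K n (shiftBy 1 ω'), ℓ (ω i) ≤ i) ↔
        ∀ i ≤ age ℓ K n (shiftBy 1 ω'), ℓ (ω' i) ≤ i :=
      forall₂_congr fun i hi => by rw [h i (by omega)]
    simp only [age, hs, hc]

lemma age_eq_zero_of_clear {ω : ℕ → E} (h : ω ∈ clear ℓ) (n : ℕ) : age ℓ K n ω = 0 := by
  cases n with
  | zero => rfl
  | succ n => rw [age, if_pos (Or.inr fun i _ => h i)]

lemma age_add {m n : ℕ} {ω : ℕ → E} (h : age ℓ K n (shiftBy m ω) = 0) :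
    age ℓ K (m + n) ω = age ℓ K m ω := by
  induction m generalizing ω with
  | zero => simpa [age] using h
  | succ m ih =>
    have hs : age ℓ K (m + n) (shiftBy 1 ω) = age ℓ K m (shiftBy 1 ω) :=
      ih (by rwa [shiftBy_shiftBy, add_comm 1 m])
    rw [show m + 1 + n = (m + n) + 1 by omega, age, age, hs]

lemma age_sub_age (n : ℕ) (ω : ℕ → E) :
    age ℓ K (n - age ℓ K n ω) (shiftBy (age ℓ K n ω) ω) = 0 := by
  induction n generalizing ω with
  | zero => simp [age]
  | succ n ih =>
    by_cases h : age ℓ K (n + 1) ω = 0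
    · rw [h]; simpa using h
    · have hs : age ℓ K (n + 1) ω = age ℓ K n (shiftBy 1 ω) + 1 := by
        rw [age] at h ⊢
        split_ifs at h ⊢ with hc
        · exact absurd rfl h
        · rfl
      rw [hs, Nat.add_sub_add_right, add_comm _ 1, ← shiftBy_shiftBy]
      exact ih _

lemma mem_renewal_iff_age {m : ℕ} {ω : ℕ → E} (h : shiftBy m ω ∈ renewal ℓ K) :
    ω ∈ renewal ℓ K ↔ age ℓ K m ω = 0 := by
  have hev : ∀ᶠ n in atTop, age ℓ K n ω = age ℓ K m ω := by
    obtain ⟨N, hN⟩ := eventually_atTop.1 h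
    refine eventually_atTop.2 ⟨m + N, fun n hn => ?_⟩
    obtain ⟨k, rfl⟩ := Nat.exists_eq_add_of_le (le_of_add_le_left hn)
    exact age_add ℓ K (hN k (by omega))
  refine ⟨fun hω => ?_, fun hω => hev.mono fun n hn => hn.trans hω⟩
  obtain ⟨n, hn, hn'⟩ := (hev.and hω).exists
  exact hn ▸ hn'

lemma clear_subset_renewal : clear ℓ ⊆ renewal ℓ K := fun _ h =>
  Eventually.of_forall (age_eq_zero_of_clear ℓ K h)

lemma exists_renewal {K : ℕ} (hK : 0 < K) {m : ℕ} (hm : K ≤ m) {ω : ℕ → E}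
    (h : shiftBy m ω ∈ clear ℓ) : ∃ i < K, shiftBy i ω ∈ renewal ℓ K := by
  have hlt := age_lt ℓ hK m ω
  refine ⟨age ℓ K m ω, hlt, (mem_renewal_iff_age ℓ K (m := m - age ℓ K m ω) ?_).2
    (age_sub_age ℓ K m ω)⟩
  rw [shiftBy_shiftBy, Nat.add_sub_cancel' (by omega)]
  exact clear_subset_renewal ℓ K h

lemma age_eq_of_not_clear {K m : ℕ} (hm : m < K) {ω : ℕ → E} (h : shiftBy m ω ∈ clear ℓ)
    (h' : ∀ i < m, shiftBy i ω ∉ clear ℓ) : age ℓ K m ω = m := by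
  induction m generalizing ω with
  | zero => rfl
  | succ m ih =>
    have hs : age ℓ K m (shiftBy 1 ω) = m := ih (by omega)
      (by rwa [shiftBy_shiftBy, add_comm 1 m])
      fun i hi => by rw [shiftBy_shiftBy, add_comm 1 i]; exact h' (i + 1) (by omega)
    rw [age, hs, if_neg]
    rintro (hK | hc)
    · omega
    · refine h' 0 (Nat.succ_pos m) fun i => ?_
      rw [shiftBy_zero]
      rcases le_or_gt i m with hi | hi
      · exact hc i hi
      · have := h (i - (m + 1))
        rw [shiftBy_apply, Nat.add_sub_cancel' (by omega)] at this
        omega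

/-- The renewals agree with the clear positions unless there is a long gap between the latter. -/
lemma mem_renewal_iff_clear {K : ℕ} {ω : ℕ → E} (h : ∃ m < K, shiftBy m ω ∈ clear ℓ) :
    ω ∈ renewal ℓ K ↔ ω ∈ clear ℓ := by
  classical
  refine ⟨fun hω => ?_, fun hω => clear_subset_renewal ℓ K hω⟩
  obtain ⟨hlt, hc⟩ := Nat.find_spec h
  have hmin (i : ℕ) (hi : i < Nat.find h) : shiftBy i ω ∉ clear ℓ := fun hcl =>
    Nat.find_min h hi ⟨hi.trans hlt, hcl⟩
  have h0 : Nat.find h = 0 := by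
    rw [← age_eq_of_not_clear ℓ hlt hc hmin]
    exact (mem_renewal_iff_age ℓ K (clear_subset_renewal ℓ K hc)).1 hω
  rwa [h0, shiftBy_zero] at hc

lemma dependsOn_clear {L : ℕ} (hL : ∀ e, ℓ e ≤ L) : DependsOn (clear ℓ) L := by
  intro x y hxy
  refine forall_congr' fun i => ?_
  rcases lt_or_ge i L with hi | hi
  · rw [hxy i hi]
  · exact iff_of_true ((hL _).trans hi) ((hL _).trans hi)

/-- The event that the renewals strictly before a renewal at position `u.length` spell `u`. -/
def pastCyl (u : List Bool) : Set (ℕ → E) :=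
  {ω | ∀ i, ∀ h : i < u.length, age ℓ K (u.length - i) (shiftBy i ω) = 0 ↔ u[i] = true}

lemma dependsOn_pastCyl (u : List Bool) : DependsOn (pastCyl ℓ K u) u.length := fun x y hxy =>
  forall₂_congr fun i hi => by
    rw [age_congr ℓ K (ω := shiftBy i x) (ω' := shiftBy i y)
      fun j hj => hxy (i + j) (by omega)]

lemma factor_mem_listCyl_append_cons {u v : List Bool} {ω : ℕ → E} :
    factor (mark (renewal ℓ K)) ω ∈ listCyl (u ++ true :: v) ↔
      ω ∈ pastCyl ℓ K u ∧
        shiftBy u.length ω ∈ factor (mark (renewal ℓ K)) ⁻¹' listCyl (true :: v) := by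
  rw [mem_listCyl_append, ← factor_shiftBy, Set.mem_preimage]
  refine and_congr_left fun h => ?_
  have h0 : shiftBy u.length ω ∈ renewal ℓ K := by
    have := mem_listCyl.1 h 0 (by simp)
    simpa [factor] using this
  rw [mem_listCyl]
  refine forall₂_congr fun i hi => ?_
  rw [← mem_renewal_iff_age ℓ K (by rwa [shiftBy_shiftBy, Nat.add_sub_cancel' hi.le]),
    Bool.eq_iff_iff]
  simp [factor]

variable [MeasurableSpace E]

@[fun_prop] lemma measurable_mark {S : Set (ℕ → E)} (hS : MeasurableSet S) :
    Measurable (mark S) :=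
  measurable_to_bool (by convert hS using 1; ext; simp)

variable {ℓ}

lemma measurableSet_clear (hℓ : Measurable ℓ) : MeasurableSet (clear ℓ) := by
  simp only [clear, Set.ofPred_forall]
  exact MeasurableSet.iInter fun i =>
    measurableSet_le (hℓ.comp (measurable_pi_apply i)) measurable_const

lemma measurable_age (hℓ : Measurable ℓ) (n : ℕ) : Measurable (age ℓ K n) := by
  induction n with
  | zero => exact measurable_const
  | succ n ih =>
    have hs : Measurable fun ω : ℕ → E => age ℓ K n (shiftBy 1 ω) := ih.comp (measurable_shiftBy 1)
    refine Measurable.ite (MeasurableSet.union ?_ ?_) measurable_const (hs.add_const 1)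
    · exact measurableSet_eq_fun (hs.add_const 1) measurable_const
    · change MeasurableSet {ω | ∀ i, i ≤ age ℓ K n (shiftBy 1 ω) → ℓ (ω i) ≤ i}
      simp only [Set.ofPred_forall, imp_iff_not_or]
      exact MeasurableSet.iInter fun i => (measurableSet_le measurable_const hs).compl.union
        (measurableSet_le (hℓ.comp (measurable_pi_apply i)) measurable_const)

lemma measurableSet_renewal (hℓ : Measurable ℓ) : MeasurableSet (renewal ℓ K) := by
  simp only [renewal, eventually_atTop, Set.ofPred_exists, Set.ofPred_forall]
  exact MeasurableSet.iUnion fun N => MeasurableSet.iInter fun n => MeasurableSet.iInter fun _ =>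
    measurable_age K hℓ n (measurableSet_singleton 0)

lemma measurableSet_pastCyl (hℓ : Measurable ℓ) (u : List Bool) :
    MeasurableSet (pastCyl ℓ K u) := by
  simp only [pastCyl, Set.ofPred_forall]
  refine MeasurableSet.iInter fun i => MeasurableSet.iInter fun hi => ?_
  have hm : MeasurableSet {ω : ℕ → E | age ℓ K (u.length - i) (shiftBy i ω) = 0} :=
    ((measurable_age K hℓ _).comp (measurable_shiftBy i)) (measurableSet_singleton 0)
  by_cases h : u[i] = true
  · simpa [h] using hm
  · convert hm.compl using 1
    ext ω
    simp [h]

end Renewal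

section RenewalLaw

variable {E : Type*}

/-- The event that no position in `[k, R)` is clear. -/
def noClear (ℓ : E → ℕ) (k R : ℕ) : Set (ℕ → E) :=
  {ω | ∀ m, k ≤ m → m < R → shiftBy m ω ∉ clear ℓ}

lemma dependsOn_noClear {ℓ : E → ℕ} {L : ℕ} (hL : ∀ e, ℓ e ≤ L) (k R : ℕ) :
    DependsOn (noClear ℓ k R) (R + L) := fun x y hxy => by
  refine forall_congr' fun m => forall₂_congr fun _ hm => not_congr ?_
  exact dependsOn_clear ℓ hL _ _ fun i hi => hxy _ (by omega)

lemma factor_renewal_congr {ℓ : E → ℕ} (K : ℕ) {m : ℕ} {x y : ℕ → E}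
    (hx : shiftBy m x ∈ clear ℓ) (hy : shiftBy m y ∈ clear ℓ) (hxy : ∀ i < m, x i = y i)
    {t : ℕ} (ht : t ≤ m) :
    factor (mark (renewal ℓ K)) x t = factor (mark (renewal ℓ K)) y t := by
  have key {z : ℕ → E} (hz : shiftBy m z ∈ clear ℓ) :
      shiftBy t z ∈ renewal ℓ K ↔ age ℓ K (m - t) (shiftBy t z) = 0 :=
    mem_renewal_iff_age ℓ K (by
      rw [shiftBy_shiftBy, Nat.add_sub_cancel' ht]
      exact clear_subset_renewal ℓ K hz)
  rw [Bool.eq_iff_iff]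
  simp only [factor, mark_eq_true]
  rw [key hx, key hy, age_congr ℓ K (ω := shiftBy t x) (ω' := shiftBy t y)
    fun j hj => hxy (t + j) (by omega)]

variable [MeasurableSpace E] (κ : Measure E) [IsProbabilityMeasure κ] {ℓ : E → ℕ}

lemma measurableSet_noClear (hℓ : Measurable ℓ) (k R : ℕ) : MeasurableSet (noClear ℓ k R) := by
  simp only [noClear, Set.ofPred_forall]
  exact MeasurableSet.iInter fun m => MeasurableSet.iInter fun _ => MeasurableSet.iInter fun _ =>
    (measurable_shiftBy m (measurableSet_clear hℓ)).compl

lemma ae_frequently_clear (hℓ : Measurable ℓ)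
    {L : ℕ} (hL : ∀ e, ℓ e ≤ L) (h0 : iid κ (clear ℓ) ≠ 0) :
    ∀ᵐ ω ∂iid κ, ∃ᶠ m in atTop, shiftBy m ω ∈ clear ℓ := by
  filter_upwards [ae_tendsto_average_of_dependsOn κ (measurableSet_clear hℓ)
    (dependsOn_clear ℓ hL)] with ω hω hcontra
  obtain ⟨N, hN⟩ := eventually_atTop.1 hcontra
  have hpos : 0 < (iid κ).real (clear ℓ) := ENNReal.toReal_pos h0 (measure_ne_top _ _)
  refine hpos.not_ge (le_of_tendsto_of_tendsto hω
    (tendsto_const_div_atTop_nhds_zero_nat (N : ℝ)) (eventually_atTop.2 ⟨N, fun n hn => ?_⟩))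
  refine div_le_div_of_nonneg_right ?_ (Nat.cast_nonneg n)
  rw [← Finset.sum_subset (Finset.range_mono hn) fun i _ hi =>
    Set.indicator_of_notMem (hN i (by simpa using hi)) _]
  calc _ ≤ ∑ _i ∈ Finset.range N, (1 : ℝ) :=
        Finset.sum_le_sum fun i _ => (le_abs_self _).trans (abs_indicator_one_le _ _)
    _ = N := by simp

lemma tendsto_noClear (hℓ : Measurable ℓ)
    {L : ℕ} (hL : ∀ e, ℓ e ≤ L) (h0 : iid κ (clear ℓ) ≠ 0) (k : ℕ) :
    Tendsto (fun R => (iid κ).real (noClear ℓ k R)) atTop (𝓝 0) := by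
  have hanti : Antitone (noClear ℓ k) := fun R R' hR ω hω m hk hm => hω m hk (hm.trans_le hR)
  have := tendsto_measure_iInter_atTop (μ := iid κ)
    (fun R => (measurableSet_noClear hℓ k R).nullMeasurableSet) hanti ⟨0, measure_ne_top _ _⟩
  have hnull : iid κ (⋂ R, noClear ℓ k R) = 0 := by
    refine measure_mono_null (fun ω hω => show ¬ ∃ᶠ m in atTop, shiftBy m ω ∈ clear ℓ from
      fun hf => ?_) (ae_iff.1 (ae_frequently_clear κ hℓ hL h0))
    obtain ⟨m, hm, hc⟩ := (frequently_atTop.1 hf) k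
    exact Set.mem_iInter.1 hω (m + 1) m hm (Nat.lt_succ_self m) hc
  rw [hnull] at this
  exact (ENNReal.tendsto_toReal ENNReal.zero_ne_top).comp this

lemma finitelyApprox_factor_renewal (hℓ : Measurable ℓ)
    {L : ℕ} (hL : ∀ e, ℓ e ≤ L) (h0 : iid κ (clear ℓ) ≠ 0) (K : ℕ)
    {B : Set (ℕ → Bool)} (hB : MeasurableSet B) {k : ℕ} (hBk : DependsOn B k) :
    FinitelyApprox κ (factor (mark (renewal ℓ K)) ⁻¹' B) := by
  intro η hη
  obtain ⟨R, hR⟩ := ((tendsto_noClear κ hℓ hL h0 k).eventually_lt_const hη).exists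
  have hN := measurableSet_noClear hℓ k R
  have hG : Measurable (mark (renewal ℓ K)) := measurable_mark (measurableSet_renewal K hℓ)
  refine ⟨R + L, (factor (mark (renewal ℓ K)) ⁻¹' B) \ noClear ℓ k R, noClear ℓ k R,
    (measurable_factor hG hB).diff hN, hN, fun x y hxy => ?_, dependsOn_noClear hL k R,
    Set.sdiff_subset, by rw [Set.sdiff_union_self]; exact Set.subset_union_left, hR⟩
  have hc := dependsOn_noClear hL k R x y hxy
  rw [Set.mem_sdiff, Set.mem_sdiff, hc]
  refine and_congr_left fun hy => ?_
  obtain ⟨m, hkm, hmR, hym⟩ : ∃ m, k ≤ m ∧ m < R ∧ shiftBy m y ∈ clear ℓ := by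
    simpa [noClear] using hy
  have hxm : shiftBy m x ∈ clear ℓ :=
    (dependsOn_clear ℓ hL _ _ fun i hi => hxy _ (by omega)).2 hym
  exact hBk _ _ fun t ht => factor_renewal_congr K hxm hym (fun i hi => hxy i (by omega))
    (by omega)

end RenewalLaw

section

variable {E α : Type*} [MeasurableSpace E] [MeasurableSpace α]
  (κ : Measure E) [IsProbabilityMeasure κ]

lemma ergodicFreq_factorLaw {F : (ℕ → E) → α} (hF : Measurable F)
    (h : ∀ k (B : Set (ℕ → α)), MeasurableSet B → DependsOn B k →
      FinitelyApprox κ (factor F ⁻¹' B)) : ErgodicFreq (factorLaw κ F) := by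
  intro k B hB hBk
  refine ⟨(iid κ).real (factor F ⁻¹' B), ?_⟩
  have hfm (n : ℕ) : Measurable fun x : ℕ → α => freq B k n x := by
    unfold freq
    split_ifs
    · refine (Finset.measurable_fun_sum _ fun i _ => ?_).div_const _
      exact ((measurable_const (a := (1 : ℝ))).indicator hB).comp (measurable_shiftBy i)
    · exact measurable_const
  refine (ae_map_iff (measurable_factor hF).aemeasurable
    (measurableSet_tendsto _ hfm)).2 ?_
  filter_upwards [ae_tendsto_average_of_finitelyApprox κ (h k B hB hBk)] with ω hω
  refine Tendsto.congr' ?_ (hω.comp (tendsto_atTop_mono (fun n => Nat.le_succ (n - k))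
    (tendsto_sub_atTop_nat k)))
  filter_upwards [eventually_ge_atTop k] with n hn
  simp only [freq, if_pos hn, Function.comp]
  push_cast [hn]
  congr 1
  refine Finset.sum_congr rfl fun i _ => ?_
  change B.indicator (fun _ => (1 : ℝ)) (factor F (shiftBy i ω)) =
    B.indicator (fun _ => (1 : ℝ)) (shiftBy i (factor F ω))
  rw [factor_shiftBy]

end

section RenewalLaw

variable {E : Type*} [MeasurableSpace E] (κ : Measure E) [IsProbabilityMeasure κ] {ℓ : E → ℕ}

lemma factorLaw_renewal_append_cons (hℓ : Measurable ℓ) (K : ℕ) (u v : List Bool) :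
    factorLaw κ (mark (renewal ℓ K)) (listCyl (u ++ true :: v)) =
      iid κ (pastCyl ℓ K u) * factorLaw κ (mark (renewal ℓ K)) (listCyl (true :: v)) := by
  have hG : Measurable (factor (mark (renewal ℓ K))) :=
    measurable_factor (measurable_mark (measurableSet_renewal K hℓ))
  unfold factorLaw
  have hm (w : List Bool) := Measure.map_apply hG (measurableSet_listCyl w) (μ := iid κ)
  rw [hm, hm,
    ← iid_inter_shiftBy κ (measurableSet_pastCyl K hℓ u) (hG (measurableSet_listCyl _))
      (dependsOn_pastCyl ℓ K u) le_rfl]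
  congr 1
  ext ω
  exact factor_mem_listCyl_append_cons ℓ K

lemma factorLaw_renewal_listCyl_eq_zero (hℓ : Measurable ℓ)
    {L : ℕ} (hL : ∀ e, ℓ e ≤ L) (h0 : iid κ (clear ℓ) ≠ 0) {K : ℕ} (hK : 0 < K)
    {u : List Bool} (hu : K ≤ u.length) (ht : true ∉ u) :
    factorLaw κ (mark (renewal ℓ K)) (listCyl u) = 0 := by
  have hG : Measurable (factor (mark (renewal ℓ K))) :=
    measurable_factor (measurable_mark (measurableSet_renewal K hℓ))
  unfold factorLaw
  rw [Measure.map_apply hG (measurableSet_listCyl _)]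
  refine measure_mono_null (fun ω hω => show ¬ ∃ᶠ m in atTop, shiftBy m ω ∈ clear ℓ from
      fun hf => ?_) (ae_iff.1 (ae_frequently_clear κ hℓ hL h0))
  obtain ⟨m, hm, hc⟩ := (frequently_atTop.1 hf) K
  obtain ⟨i, hi, hr⟩ := exists_renewal ℓ hK hm hc
  have := mem_listCyl.1 hω i (hi.trans_le hu)
  rw [factor, mark_eq_true.2 hr] at this
  exact ht (this ▸ List.getElem_mem _)

lemma isMarkovOfOrder_renewal (hℓ : Measurable ℓ)
    {L : ℕ} (hL : ∀ e, ℓ e ≤ L) (h0 : iid κ (clear ℓ) ≠ 0) {K : ℕ} (hK : 0 < K) :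
    IsMarkovOfOrder (factorLaw κ (mark (renewal ℓ K))) K := by
  intro w a hw
  obtain ⟨w', l, hl, rfl⟩ : ∃ w' l : List Bool, l.length = K ∧ w = w' ++ l :=
    ⟨w.take (w.length - K), w.drop (w.length - K), by simp; omega, by simp⟩
  have hd : (w' ++ l).drop ((w' ++ l).length - K) = l := by
    rw [List.length_append, hl, Nat.add_sub_cancel, List.drop_left]
  rw [hd]
  by_cases ht : true ∈ l
  · obtain ⟨u, v, rfl⟩ := List.append_of_mem ht
    have e1 : w' ++ (u ++ true :: v) ++ [a] = (w' ++ u) ++ true :: (v ++ [a]) := by simp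
    have e2 : u ++ true :: v ++ [a] = u ++ true :: (v ++ [a]) := by simp
    rw [e1, e2, ← List.append_assoc, factorLaw_renewal_append_cons κ hℓ,
      factorLaw_renewal_append_cons κ hℓ, factorLaw_renewal_append_cons κ hℓ,
      factorLaw_renewal_append_cons κ hℓ]
    ring
  · have hl0 := factorLaw_renewal_listCyl_eq_zero κ hℓ hL h0 hK hl.ge ht
    have hw0 : factorLaw κ (mark (renewal ℓ K)) (listCyl (w' ++ l)) = 0 := by
      have hG : Measurable (factor (mark (renewal ℓ K))) :=
        measurable_factor (measurable_mark (measurableSet_renewal K hℓ))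
      unfold factorLaw at hl0 ⊢
      rw [Measure.map_apply hG (measurableSet_listCyl _)] at hl0 ⊢
      rw [← (measurePreserving_shiftBy κ w'.length).measure_preimage
        (hG (measurableSet_listCyl _)).nullMeasurableSet] at hl0
      refine measure_mono_null (fun ω hω => ?_) hl0
      have := (mem_listCyl_append.1 hω).2
      rwa [← factor_shiftBy] at this
    rw [hl0, hw0, mul_zero, mul_zero]

lemma aperiodicMarkov_renewal (hℓ : Measurable ℓ)
    {L : ℕ} (hL : ∀ e, ℓ e ≤ L) (h0 : iid κ (clear ℓ) ≠ 0) (K k : ℕ) :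
    AperiodicMarkov (factorLaw κ (mark (renewal ℓ K))) k := by
  intro u _ hu d hd
  have hG : Measurable (factor (mark (renewal ℓ K))) :=
    measurable_factor (measurable_mark (measurableSet_renewal K hℓ))
  have hS := measurableSet_listCyl u
  set S := factor (mark (renewal ℓ K)) ⁻¹' listCyl u with hSdef
  have hS0 : iid κ S ≠ 0 := by rwa [factorLaw, Measure.map_apply hG hS] at hu
  obtain ⟨N, U, T, hU, -, hUN, -, hUS, hST, hT⟩ :=
    finitelyApprox_factor_renewal κ hℓ hL h0 K hS (dependsOn_listCyl u)
      ((iid κ).real S) (ENNReal.toReal_pos hS0 (measure_ne_top _ _))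
  have hU0 : iid κ U ≠ 0 := fun hU0 => by
    have h1 : (iid κ).real U = 0 := by simp [Measure.real, hU0]
    have h2 := (measureReal_mono (μ := iid κ) hST).trans (measureReal_union_le _ _)
    linarith
  have hdvd (n : ℕ) (hn : N ≤ n) (hn1 : 1 ≤ n) : d ∣ n := by
    refine hd n hn1 fun hzero => mul_ne_zero hU0 hS0 ?_
    rw [← iid_inter_shiftBy κ hU (hG hS) hUN hn]
    change factorLaw κ _ (listCyl u ∩ shiftBy n ⁻¹' listCyl u) = 0 at hzero
    rw [factorLaw, Measure.map_apply hG (hS.inter (measurable_shiftBy n hS))] at hzero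
    refine measure_mono_null (t := factor (mark (renewal ℓ K)) ⁻¹'
      (listCyl u ∩ shiftBy n ⁻¹' listCyl u))
      (fun ω hω => ⟨hUS hω.1, ?_⟩) hzero
    rw [Set.mem_preimage, ← factor_shiftBy]
    exact hω.2
  exact Nat.dvd_one.1 ((Nat.dvd_add_right (hdvd (N + 1) (by omega) (by omega))).1
    (hdvd (N + 1 + 1) (by omega) (by omega)))

end RenewalLaw

/-- A factor of an i.i.d. sequence that is approximated by clear events of bounded masks is a
B-process. -/
lemma isBProcess_factorLaw {E : Type*} [MeasurableSpace E] (κ : Measure E)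
    [IsProbabilityMeasure κ] {F : (ℕ → E) → Bool} (hF : Measurable F)
    (h : ∀ ε : ℝ, 0 < ε → ∃ (ℓ : E → ℕ) (L : ℕ), Measurable ℓ ∧ (∀ e, ℓ e ≤ L) ∧
      iid κ (clear ℓ) ≠ 0 ∧ (iid κ).real {ω | F ω ≠ mark (clear ℓ) ω} ≤ ε) :
    IsBProcess (factorLaw κ F) := by
  refine ⟨isProbabilityMeasure_factorLaw κ hF, stationary_factorLaw κ hF, fun ε hε => ?_⟩
  obtain ⟨ℓ, L, hℓ, hL, h0, hFℓ⟩ := h (ε / 2) (by positivity)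
  obtain ⟨K, hKε, hK⟩ := (((tendsto_noClear κ hℓ hL h0 0).eventually_lt_const
    (show 0 < ε / 2 by positivity)).and (eventually_gt_atTop 0)).exists
  have hG : Measurable (mark (renewal ℓ K)) := measurable_mark (measurableSet_renewal K hℓ)
  refine ⟨factorLaw κ (mark (renewal ℓ K)), K, isProbabilityMeasure_factorLaw κ hG,
    stationary_factorLaw κ hG, ergodicFreq_factorLaw κ hG fun k B hB hBk =>
      finitelyApprox_factor_renewal κ hℓ hL h0 K hB hBk,
    isMarkovOfOrder_renewal κ hℓ hL h0 hK, aperiodicMarkov_renewal κ hℓ hL h0 K K,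
    dbarLe_factorLaw κ hF hG ?_⟩
  rw [ENNReal.le_ofReal_iff_toReal_le (measure_ne_top _ _) hε.le]
  have hsub : {ω | F ω ≠ mark (renewal ℓ K) ω} ⊆
      {ω | F ω ≠ mark (clear ℓ) ω} ∪ noClear ℓ 0 K := by
    intro ω hω
    by_contra! hcon
    simp only [Set.mem_union, not_or] at hcon
    obtain ⟨hc, hn⟩ := hcon
    simp only [noClear, Set.mem_ofPred_eq, not_forall, not_not] at hn hc
    obtain ⟨m, -, hm, hcl⟩ := hn
    refine hω (hc.trans ?_)
    rw [Bool.eq_iff_iff, mark_eq_true, mark_eq_true, mem_renewal_iff_clear ℓ ⟨m, hm, hcl⟩]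
  calc (iid κ).real {ω | F ω ≠ mark (renewal ℓ K) ω}
      ≤ (iid κ).real {ω | F ω ≠ mark (clear ℓ) ω} + (iid κ).real (noClear ℓ 0 K) :=
        (measureReal_mono hsub).trans (measureReal_union_le _ _)
    _ ≤ ε := by linarith

section Mask

/-- The distribution of a sequence of independent uniform variables. -/
noncomputable def seedLaw : Measure (ℕ → unitInterval) := Measure.infinitePi fun _ => volume

instance : IsProbabilityMeasure seedLaw := by unfold seedLaw; infer_instance

/-- The mask of length at least `L j` whenever the `j`-th coordinate exceeds `θ j`, for some `j`
in `s`. -/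
noncomputable def mask (θ : ℕ → unitInterval) (L : ℕ → ℕ) (s : Finset ℕ) (e : ℕ → unitInterval) :
    ℕ :=
  s.sup fun j => if e j ≤ θ j then 0 else L j

variable {θ : ℕ → unitInterval} {L : ℕ → ℕ} {s : Finset ℕ}

lemma mask_le (e : ℕ → unitInterval) : mask θ L s e ≤ s.sup L :=
  Finset.sup_mono_fun fun j _ => by split_ifs <;> simp

lemma measurable_mask : Measurable (mask θ L s) := by
  unfold mask
  induction s using Finset.cons_induction with
  | empty => exact measurable_const
  | cons a s ha ih =>
    simp only [Finset.sup_cons]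
    exact (Measurable.ite (measurableSet_le (measurable_pi_apply a) measurable_const)
      measurable_const measurable_const).sup ih

lemma mem_clear_mask {ω : ℕ → ℕ → unitInterval} :
    ω ∈ clear (mask θ L s) ↔ ∀ j ∈ s, ∀ i < L j, ω i j ≤ θ j := by
  change (∀ i, mask θ L s (ω i) ≤ i) ↔ _
  simp only [mask, Finset.sup_le_iff]
  refine ⟨fun h j hj i hi => ?_, fun h i j hj => ?_⟩
  · by_contra hc
    have := h i j hj
    rw [if_neg hc] at this
    omega
  · split_ifs with hc
    · exact Nat.zero_le i
    · by_contra hi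
      exact hc (h j hj i (not_le.1 hi))

lemma iid_clear_mask : iid seedLaw (clear (mask θ L s)) =
    ∏ j ∈ s, ENNReal.ofReal (θ j) ^ L j := by
  have hbox : clear (mask θ L s) = Set.pi (Finset.range (s.sup L)) fun i =>
      Set.pi s fun j => if i < L j then Set.Iic (θ j) else Set.univ := by
    ext ω
    rw [mem_clear_mask]
    simp only [Set.mem_pi, Finset.mem_coe, Finset.mem_range]
    refine ⟨fun h i _ j hj => ?_, fun h j hj i hi => ?_⟩
    · split_ifs with hi
      · exact h j hj i hi
      · trivial
    · have := h i (hi.trans_le (Finset.le_sup hj)) j hj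
      rwa [if_pos hi] at this
  have hm (i j : ℕ) : MeasurableSet (if i < L j then Set.Iic (θ j) else Set.univ) := by
    split_ifs
    · exact measurableSet_Iic
    · exact MeasurableSet.univ
  rw [hbox, iid, Measure.infinitePi_pi _ fun i _ => ?_]
  · have hrow (i : ℕ) : seedLaw (Set.pi s fun j => if i < L j then Set.Iic (θ j) else Set.univ) =
        ∏ j ∈ s, if i < L j then ENNReal.ofReal (θ j) else 1 := by
      rw [seedLaw, Measure.infinitePi_pi _ fun j _ => hm i j]
      refine Finset.prod_congr rfl fun j _ => ?_
      split_ifs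
      · exact unitInterval.volume_Iic _
      · exact measure_univ
    simp only [hrow]
    rw [Finset.prod_comm]
    refine Finset.prod_congr rfl fun j hj => ?_
    rw [← Finset.prod_subset (Finset.range_mono (Finset.le_sup hj)) fun i _ hi =>
      if_neg (by simpa using hi),
      Finset.prod_congr rfl fun i hi => if_pos (Finset.mem_range.1 hi)]
    simp
  · exact MeasurableSet.pi s.countable_toSet fun j _ => hm i j

lemma measurableSet_clear_mask : MeasurableSet (clear (mask θ L s)) :=
  measurableSet_clear measurable_mask

lemma isBProcess_clear_mask (hθ : ∀ j ∈ s, θ j ≠ 0) :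
    IsBProcess (factorLaw seedLaw (mark (clear (mask θ L s)))) :=
  isBProcess_factorLaw seedLaw (measurable_mark measurableSet_clear_mask) fun ε hε =>
    ⟨mask θ L s, s.sup L, measurable_mask, mask_le, by
      rw [iid_clear_mask]
      refine Finset.prod_ne_zero_iff.2 fun j hj => pow_ne_zero _ ?_
      exact (ENNReal.ofReal_pos.2 (unitInterval.pos_iff_ne_zero.2 (hθ j hj))).ne', by
      simpa using hε.le⟩

end Mask

section Target

/-- The probability that no mask of level `j` reaches the origin. -/
noncomputable def clearProb (j : ℕ) : ℝ := 1 - 1 / ((j : ℝ) + 2) ^ 2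

lemma clearProb_pos (j : ℕ) : 0 < clearProb j := by
  have : 1 / ((j : ℝ) + 2) ^ 2 < 1 := by
    rw [div_lt_one (by positivity)]
    nlinarith [(Nat.cast_nonneg j : (0 : ℝ) ≤ j)]
  unfold clearProb
  linarith

lemma clearProb_le_one (j : ℕ) : clearProb j ≤ 1 := by
  have : 0 ≤ 1 / ((j : ℝ) + 2) ^ 2 := by positivity
  unfold clearProb
  linarith

lemma prod_clearProb (J : ℕ) :
    ∏ j ∈ Finset.range J, clearProb j = 1 / 2 + 1 / (2 * ((J : ℝ) + 1)) := by
  induction J with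
  | zero => norm_num
  | succ J ih =>
    rw [Finset.prod_range_succ, ih, clearProb]
    push_cast
    field_simp
    ring

/-- The threshold below which `n` independent uniform variables lie with probability
`clearProb j`. -/
noncomputable def threshold (L : ℕ → ℕ) (j : ℕ) : unitInterval :=
  ⟨clearProb j ^ ((L j : ℝ)⁻¹), Real.rpow_nonneg (clearProb_pos j).le _,
    Real.rpow_le_one (clearProb_pos j).le (clearProb_le_one j) (by positivity)⟩

/-- The lengths `L` mask, at the levels in `s`. -/
noncomputable abbrev levels (L : ℕ → ℕ) (s : Finset ℕ) : (ℕ → unitInterval) → ℕ :=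
  mask (threshold L) L s

/-- The event that no mask of any level reaches the origin. -/
def clearAll (L : ℕ → ℕ) : Set (ℕ → ℕ → unitInterval) :=
  {ω | ∀ j, ∀ i < L j, ω i j ≤ threshold L j}

lemma threshold_ne_zero (L : ℕ → ℕ) (j : ℕ) : threshold L j ≠ 0 := fun h =>
  (Real.rpow_pos_of_pos (clearProb_pos j) _).ne' (congrArg Subtype.val h)

variable {L : ℕ → ℕ}

lemma clearAll_eq : clearAll L = ⋂ J, clear (levels L (Finset.range J)) := by
  ext ω
  simp only [Set.mem_iInter, mem_clear_mask, Finset.mem_range]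
  exact ⟨fun h J j _ => h j, fun h j => h (j + 1) j (Nat.lt_succ_self j)⟩

lemma measurableSet_clearAll : MeasurableSet (clearAll L) :=
  clearAll_eq ▸ MeasurableSet.iInter fun _ => measurableSet_clear_mask

lemma iid_clear_levels (hL : ∀ j, 1 ≤ L j) (s : Finset ℕ) :
    (iid seedLaw).real (clear (levels L s)) = ∏ j ∈ s, clearProb j := by
  rw [Measure.real, iid_clear_mask, ENNReal.toReal_prod]
  refine Finset.prod_congr rfl fun j _ => ?_
  rw [ENNReal.toReal_pow, ENNReal.toReal_ofReal (threshold L j).2.1]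
  exact Real.rpow_inv_natCast_pow (clearProb_pos j).le (Nat.one_le_iff_ne_zero.1 (hL j))

lemma iid_clearAll (hL : ∀ j, 1 ≤ L j) : (iid seedLaw).real (clearAll L) = 1 / 2 := by
  have hanti : Antitone fun J => clear (levels L (Finset.range J)) := fun J J' h ω hω =>
    mem_clear_mask.2 fun j hj => mem_clear_mask.1 hω j (Finset.range_mono h hj)
  have h1 := (ENNReal.tendsto_toReal (measure_ne_top _ _)).comp
    (tendsto_measure_iInter_atTop (μ := iid seedLaw)
      (fun J => measurableSet_clear_mask.nullMeasurableSet) hanti ⟨0, measure_ne_top _ _⟩)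
  rw [← clearAll_eq] at h1
  refine tendsto_nhds_unique h1 ?_
  have h2 : Tendsto (fun J : ℕ => 1 / 2 + 1 / 2 * (1 / ((J : ℝ) + 1))) atTop (𝓝 (1 / 2)) := by
    have := ((tendsto_one_div_add_atTop_nhds_zero_nat (𝕜 := ℝ)).const_mul (1 / 2)).const_add (1 / 2)
    rwa [mul_zero, add_zero] at this
  refine h2.congr fun J => ?_
  change _ = (iid seedLaw).real (clear (levels L (Finset.range J)))
  rw [iid_clear_levels hL, prod_clearProb]
  field_simp

lemma iid_not_clear_level (hL : ∀ j, 1 ≤ L j) (j : ℕ) : iid seedLaw (clear (levels L {j}))ᶜ =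
    ENNReal.ofReal (1 / ((j : ℝ) + 2) ^ 2) := by
  rw [← ENNReal.ofReal_toReal (measure_ne_top (iid seedLaw) _)]
  congr 1
  change (iid seedLaw).real _ = _
  rw [probReal_compl_eq_one_sub measurableSet_clear_mask, iid_clear_levels hL]
  simp [clearProb]

/-- The levels from `J` on are unlikely to matter in a window that is shorter than their masks. -/
lemma iid_exists_ne_le (hL : ∀ j, 1 ≤ L j) {J n : ℕ} (hn : ∀ j, J ≤ j → n ≤ L j) :
    (iid seedLaw).real {ω | ∃ t < n, mark (clear (levels L (Finset.range J))) (shiftBy t ω) ≠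
      mark (clearAll L) (shiftBy t ω)} ≤ 2 / ((J : ℝ) + 1) := by
  set bad : ℕ → Set (ℕ → ℕ → unitInterval) := fun j => (clear (levels L {j}))ᶜ with hbad
  have hmem {j : ℕ} {ω : ℕ → ℕ → unitInterval} (i : ℕ) (hi : i < L j)
      (h : ¬ ω i j ≤ threshold L j) : ω ∈ bad j := fun hc =>
    h (mem_clear_mask.1 hc j (Finset.mem_singleton_self j) i hi)
  have hsub : {ω | ∃ t < n, mark (clear (levels L (Finset.range J))) (shiftBy t ω) ≠
      mark (clearAll L) (shiftBy t ω)} ⊆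
      ⋃ k : ℕ, bad (J + k) ∪ shiftBy (L (J + k)) ⁻¹' bad (J + k) := by
    rintro ω ⟨t, ht, hne⟩
    by_contra hcon
    refine hne ?_
    rw [Bool.eq_iff_iff, mark_eq_true, mark_eq_true, mem_clear_mask]
    refine ⟨fun h j i hi => ?_, fun h j _ => h j⟩
    rcases lt_or_ge j J with hj | hj
    · exact h j (Finset.mem_range.2 hj) i hi
    by_contra hlt
    refine hcon (Set.mem_iUnion.2 ⟨j - J, ?_⟩)
    rw [Nat.add_sub_cancel' hj]
    have := hn j hj
    rcases lt_or_ge (t + i) (L j) with hti | hti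
    · exact Or.inl (hmem (t + i) hti hlt)
    · refine Or.inr (hmem (t + i - L j) (by omega) ?_)
      rwa [shiftBy_apply, Nat.add_sub_cancel' hti]
  refine ENNReal.toReal_le_of_le_ofReal (by positivity) ?_
  refine (measure_mono hsub).trans ((measure_iUnion_le _).trans
    (ENNReal.tsum_le_of_sum_range_le fun m => ?_))
  have hterm (k : ℕ) : iid seedLaw (bad (J + k) ∪ shiftBy (L (J + k)) ⁻¹' bad (J + k)) ≤
      ENNReal.ofReal (2 / ((J : ℝ) + k + 2) ^ 2) := by
    refine (measure_union_le _ _).trans_eq ?_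
    rw [(measurePreserving_shiftBy seedLaw _).measure_preimage
      measurableSet_clear_mask.compl.nullMeasurableSet, hbad, iid_not_clear_level hL,
      ← ENNReal.ofReal_add (by positivity) (by positivity)]
    congr 1
    push_cast
    ring
  have hsum (m : ℕ) : ∑ k ∈ Finset.range m, 2 / ((J : ℝ) + k + 2) ^ 2 ≤
      2 / ((J : ℝ) + 1) - 2 / ((J : ℝ) + m + 1) := by
    induction m with
    | zero => simp
    | succ m ih =>
      rw [Finset.sum_range_succ]
      have : 2 / ((J : ℝ) + m + 2) ^ 2 ≤ 2 / ((J : ℝ) + m + 1) - 2 / ((J : ℝ) + m + 2) := by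
        rw [div_sub_div _ _ (by positivity) (by positivity),
          div_le_div_iff₀ (by positivity) (by positivity)]
        have h0 : 0 ≤ (J : ℝ) + m := by positivity
        nlinarith
      push_cast
      rw [show (J : ℝ) + (m + 1) + 1 = J + m + 2 by ring]
      linarith
  calc ∑ k ∈ Finset.range m, iid seedLaw (bad (J + k) ∪ shiftBy (L (J + k)) ⁻¹' bad (J + k))
      ≤ ∑ k ∈ Finset.range m, ENNReal.ofReal (2 / ((J : ℝ) + k + 2) ^ 2) :=
        Finset.sum_le_sum fun k _ => hterm k
    _ = ENNReal.ofReal (∑ k ∈ Finset.range m, 2 / ((J : ℝ) + k + 2) ^ 2) :=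
        (ENNReal.ofReal_sum_of_nonneg fun _ _ => by positivity).symm
    _ ≤ ENNReal.ofReal (2 / ((J : ℝ) + 1)) := by
        refine ENNReal.ofReal_le_ofReal ((hsum m).trans ?_)
        have : 0 ≤ 2 / ((J : ℝ) + m + 1) := by positivity
        linarith

lemma isBProcess_clearAll (hL : ∀ j, 1 ≤ L j) :
    IsBProcess (factorLaw seedLaw (mark (clearAll L))) := by
  refine isBProcess_factorLaw seedLaw (measurable_mark measurableSet_clearAll) fun ε hε => ?_
  obtain ⟨J, hJ⟩ := exists_nat_one_div_lt (show 0 < ε / 2 by positivity)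
  refine ⟨levels L (Finset.range J), _, measurable_mask, mask_le, fun h0 => ?_, ?_⟩
  · have := iid_clear_levels hL (Finset.range J)
    rw [Measure.real, h0, ENNReal.toReal_zero] at this
    exact (Finset.prod_pos fun j _ => clearProb_pos j).ne this
  · refine (measureReal_mono fun ω hω => ?_).trans
      ((iid_exists_ne_le hL (J := J) (n := 1) fun j _ => hL j).trans ?_)
    · exact ⟨0, Nat.one_pos, by simpa using Ne.symm hω⟩
    · have : 2 / ((J : ℝ) + 1) = 2 * (1 / ((J : ℝ) + 1)) := by ring
      linarith

end Target

section Discrimination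

lemma factorLaw_mark_false {E : Type*} [MeasurableSpace E] (κ : Measure E) [IsProbabilityMeasure κ]
    {S : Set (ℕ → E)} (hS : MeasurableSet S) :
    factorLaw κ (mark S) {x | x 0 = false} = ENNReal.ofReal (1 - (iid κ).real S) := by
  have hm : MeasurableSet {x : ℕ → Bool | x 0 = false} :=
    measurableSet_eq_fun (measurable_pi_apply 0) measurable_const
  rw [← probReal_compl_eq_one_sub hS, ofReal_measureReal, factorLaw,
    Measure.map_apply (measurable_factor (measurable_mark hS)) hm]
  congr 1
  ext ω
  simp [factor]

lemma expOut_factorLaw_le {E : Type*} [MeasurableSpace E] (κ : Measure E) [IsProbabilityMeasure κ]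
    {D : (n : ℕ) → (Fin n → Bool) → (Fin n → Bool) → Bool} {n : ℕ}
    (hD : Measurable fun p : (Fin n → Bool) × (Fin n → Bool) => D n p.1 p.2)
    {F G : (ℕ → E) → Bool} (hF : Measurable F) (hG : Measurable G)
    (ρ : Measure (ℕ → Bool)) [IsProbabilityMeasure ρ] :
    expOut D (factorLaw κ F) ρ n ≤ expOut D (factorLaw κ G) ρ n +
      (iid κ).real {ω | ∃ t < n, F (shiftBy t ω) ≠ G (shiftBy t ω)} := by
  set A₀ : Set ((ℕ → Bool) × (ℕ → Bool)) :=
    {z | D n (fun i => z.1 i) (fun i => z.2 i) = true} with hA₀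
  have hAm : MeasurableSet A₀ :=
    (hD.comp (f := fun z : (ℕ → Bool) × (ℕ → Bool) =>
      ((fun i : Fin n => z.1 i), (fun i : Fin n => z.2 i))) (by fun_prop))
      (measurableSet_singleton true)
  have key {H : (ℕ → E) → Bool} (hH : Measurable H) : expOut D (factorLaw κ H) ρ n =
      ((iid κ).prod ρ).real (Prod.map (factor H) id ⁻¹' A₀) := by
    have h1 : expOut D (factorLaw κ H) ρ n =
        ∫ z, A₀.indicator 1 z ∂((factorLaw κ H).prod ρ) := by
      refine integral_congr_ae (ae_of_all _ fun z => ?_)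
      by_cases hz : z ∈ A₀
      · simp only [Set.indicator_of_mem hz]
        exact if_pos hz
      · simp only [Set.indicator_of_notMem hz]
        exact if_neg hz
    have h2 : (factorLaw κ H).prod ρ = ((iid κ).prod ρ).map (Prod.map (factor H) id) := by
      rw [← Measure.map_prod_map _ _ (measurable_factor hH) measurable_id, Measure.map_id]
      rfl
    rw [h1, integral_indicator_one hAm, h2,
      map_measureReal_apply ((measurable_factor hH).prodMap measurable_id) hAm]
  rw [key hF, key hG]
  have hT : (iid κ).real {ω | ∃ t < n, F (shiftBy t ω) ≠ G (shiftBy t ω)} =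
      ((iid κ).prod ρ).real
        ({ω | ∃ t < n, F (shiftBy t ω) ≠ G (shiftBy t ω)} ×ˢ Set.univ) := by
    simp [Measure.real]
  rw [hT]
  refine (measureReal_mono fun z hz => ?_).trans (measureReal_union_le _ _)
  by_cases h : ∃ t < n, F (shiftBy t z.1) ≠ G (shiftBy t z.1)
  · exact Or.inr ⟨h, trivial⟩
  · push Not at h
    left
    have he : (fun i : Fin n => factor F z.1 i) = fun i : Fin n => factor G z.1 i :=
      funext fun i => h i i.2
    simp only [hA₀, Set.mem_preimage, Set.mem_ofPred_eq, Prod.map_fst] at hz ⊢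
    rwa [← he]

/-- The sequence with `L j = 1 + ∑ i ≤ j, N i L'`, where `L'` is `L` restricted to `[0, j)`. -/
def dominating (N : ℕ → (ℕ → ℕ) → ℕ) (j : ℕ) : ℕ :=
  1 + ∑ i ∈ Finset.range (j + 1), N i fun k => if _h : k < j then dominating N k else 0
termination_by j

lemma le_dominating {N : ℕ → (ℕ → ℕ) → ℕ}
    (hN : ∀ J L L', (∀ i < J, L i = L' i) → N J L = N J L') {J j : ℕ} (hJ : J ≤ j) :
    N J (dominating N) ≤ dominating N j := by
  rw [hN J (dominating N) (fun k => if _h : k < j then dominating N k else 0)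
    fun i hi => by simp [hi.trans_le hJ]]
  conv_rhs => rw [dominating]
  refine le_trans ?_ (Nat.le_add_left _ _)
  exact Finset.single_le_sum
    (f := fun i => N i fun k => if _h : k < j then dominating N k else 0)
    (fun _ _ => Nat.zero_le _) (Finset.mem_range.2 (Nat.lt_succ_of_le hJ))

lemma one_le_dominating (N : ℕ → (ℕ → ℕ) → ℕ) (j : ℕ) : 1 ≤ dominating N j := by
  rw [dominating]
  exact Nat.le_add_right _ _

lemma levels_congr {L L' : ℕ → ℕ} {J : ℕ} (h : ∀ i < J, L i = L' i) :
    levels L (Finset.range J) = levels L' (Finset.range J) := by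
  ext e
  refine Finset.sup_congr rfl fun j hj => ?_
  have := h j (Finset.mem_range.1 hj)
  have ht : threshold L j = threshold L' j := by unfold threshold; simp only [this]
  rw [ht, this]

end Discrimination

open Classical in
/-- There is no procedure that asymptotically discriminates equality of the
single-dimensional marginals of (binary-valued) B-processes: no family `D_n` of measurable
maps is such that for all B-processes `ρx, ρy` (independently generating the two samples)
`E D_n` converges to 0 if `ρx(X_1 = 0) = ρy(Y_1 = 0)` and to 1 otherwise. -/
theorem no_discrimination_of_marginals_of_B_processes :
    ¬ ∃ D : (n : ℕ) → (Fin n → Bool) → (Fin n → Bool) → Bool,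
      (∀ n, Measurable fun p : (Fin n → Bool) × (Fin n → Bool) => D n p.1 p.2) ∧
      ∀ ρx ρy : Measure (ℕ → Bool), IsBProcess ρx → IsBProcess ρy →
        Tendsto (expOut D ρx ρy) atTop
          (𝓝 (if ρx {x | x 0 = false} = ρy {y | y 0 = false} then (0 : ℝ) else 1)) := by
  rintro ⟨D, hD, hlim⟩
  set fair : (ℕ → ℕ → unitInterval) → Bool :=
    mark (clear (mask (fun _ => ⟨1 / 2, by norm_num, by norm_num⟩) 1 {0})) with hfair
  have hfairm : Measurable fair := measurable_mark measurableSet_clear_mask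
  have := isProbabilityMeasure_factorLaw seedLaw hfairm
  have hfairB : IsBProcess (factorLaw seedLaw fair) := isBProcess_clear_mask fun j _ h =>
    absurd (congrArg Subtype.val h) (by norm_num)
  have hfair0 : factorLaw seedLaw fair {y | y 0 = false} = ENNReal.ofReal (1 - 1 / 2) := by
    rw [factorLaw_mark_false seedLaw measurableSet_clear_mask, Measure.real, iid_clear_mask]
    norm_num
  have hchoice (J : ℕ) (ρ : Measure (ℕ → Bool)) : ∃ n,
      (∃ m, J ≤ m ∧ 3 / 4 < expOut D ρ (factorLaw seedLaw fair) m) →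
        J ≤ n ∧ 3 / 4 < expOut D ρ (factorLaw seedLaw fair) n := by
    by_cases h : ∃ m, J ≤ m ∧ 3 / 4 < expOut D ρ (factorLaw seedLaw fair) m
    · exact h.imp fun n hn _ => hn
    · exact ⟨0, fun h' => absurd h' h⟩
  choose g hg using hchoice
  set N : ℕ → (ℕ → ℕ) → ℕ := fun J L =>
    g J (factorLaw seedLaw (mark (clear (levels L (Finset.range J))))) with hN
  have hNL (J j : ℕ) (hj : J ≤ j) : N J (dominating N) ≤ dominating N j :=
    le_dominating (fun J L L' h => by simp only [hN, levels_congr h]) hj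
  have hL := one_le_dominating N
  set L := dominating N
  have hnear (J : ℕ) : J ≤ N J L ∧ 3 / 4 < expOut D
      (factorLaw seedLaw (mark (clear (levels L (Finset.range J))))) (factorLaw seedLaw fair)
        (N J L) := by
    refine hg J _ ?_
    have h := hlim _ _ (isBProcess_clear_mask (L := L) (s := Finset.range J)
      fun j _ => threshold_ne_zero L j) hfairB
    rw [hfair0, factorLaw_mark_false seedLaw measurableSet_clear_mask, iid_clear_levels hL,
      prod_clearProb, if_neg] at h
    · exact ((eventually_ge_atTop J).and (h.eventually_const_lt (by norm_num))).exists
    · refine (ENNReal.ofReal_lt_ofReal_iff (by norm_num)).2 ?_ |>.ne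
      have : 0 < 1 / (2 * ((J : ℝ) + 1)) := by positivity
      linarith
  have hfar := hlim _ _ (isBProcess_clearAll hL) hfairB
  rw [hfair0, factorLaw_mark_false seedLaw measurableSet_clearAll, iid_clearAll hL,
    if_pos rfl] at hfar
  obtain ⟨M, hM⟩ := eventually_atTop.1 (hfar.eventually_lt_const (show (0 : ℝ) < 1 / 2 by norm_num))
  obtain ⟨hle, hgt⟩ := hnear (max M 7)
  have h1 := hM _ ((le_max_left M 7).trans hle)
  have h2 := expOut_factorLaw_le seedLaw (hD (N (max M 7) L))
    (measurable_mark (measurableSet_clear_mask (θ := threshold L) (L := L)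
      (s := Finset.range (max M 7)))) (measurable_mark (measurableSet_clearAll (L := L)))
    (factorLaw seedLaw fair)
  have h3 := iid_exists_ne_le hL (hNL (max M 7))
  have h4 : 2 / (((max M 7 : ℕ) : ℝ) + 1) ≤ 1 / 4 := by
    have : (7 : ℝ) ≤ ((max M 7 : ℕ) : ℝ) := by exact_mod_cast le_max_right M 7
    rw [div_le_div_iff₀ (by positivity) (by norm_num)]
    linarith
  linarith

end Paper
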